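/- (Baillon–Haddad) Let F : E → ℝ be convex and differentiable with β-Lipschitz gradient (β > 0). Then for all x, y ∈ E, ⟨∇F(x) − ∇F(y), x − y⟩ ≥ (1/β)‖∇F(x) − ∇F(y)‖². -/

import Mathlib

open scoped RealInnerProductSpace

noncomputable section

section Gradient

variable {E : Type*} [NormedAddCommGroup E] [InnerProductSpace ℝ E] [CompleteSpace E]
  {F : E → ℝ} {β : ℝ}

/-- The derivative of a differentiable function along a line, in terms of its gradient. -/
theorem hasDerivAt_comp_line_gradient (hF : Differentiable ℝ F) (a v : E) (t : ℝ) :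
    HasDerivAt (fun s : ℝ => F (a + s • v)) ⟪gradient F (a + t • v), v⟫ t := by
  have hline : HasDerivAt (fun s : ℝ => a + s • v) v t := by
    simpa using ((hasDerivAt_id t).smul_const v).const_add a
  rw [inner_gradient_left]
  exact (hF (a + t • v)).hasFDerivAt.comp_hasDerivAt t hline

/-- A differentiable convex function lies above its tangent planes. -/
theorem ConvexOn.add_inner_gradient_le (hFc : ConvexOn ℝ Set.univ F)
    (hF : Differentiable ℝ F) (a v : E) :
    F a + ⟪gradient F a, v⟫ ≤ F (a + v) := by
  have hconv : ConvexOn ℝ Set.univ (fun s : ℝ => F (a + s • v)) := by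
    have h := hFc.comp_affineMap (AffineMap.lineMap a (a + v) : ℝ →ᵃ[ℝ] E)
    simpa [Function.comp_def, AffineMap.lineMap_apply, add_comm] using h
  have h := hconv.le_slope_of_hasDerivAt (Set.mem_univ 0) (Set.mem_univ 1) one_pos
    (hasDerivAt_comp_line_gradient hF a v 0)
  simp [slope_def_field, -inner_gradient_left] at h
  linarith

/-- The descent lemma: a function with `β`-Lipschitz gradient lies below the corresponding
quadratic upper model. -/
theorem le_add_inner_gradient_add_sq (hF : Differentiable ℝ F)
    (hlip : ∀ a b, ‖gradient F a - gradient F b‖ ≤ β * ‖a - b‖) (a v : E) :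
    F (a + v) ≤ F a + ⟪gradient F a, v⟫ + β / 2 * ‖v‖ ^ 2 := by
  have hderiv (t : ℝ) : HasDerivAt
      (fun s : ℝ => F (a + s • v) - s * ⟪gradient F a, v⟫ - β / 2 * ‖v‖ ^ 2 * s ^ 2)
      (⟪gradient F (a + t • v), v⟫ - ⟪gradient F a, v⟫ - β * ‖v‖ ^ 2 * t) t := by
    refine HasDerivAt.congr_deriv (((hasDerivAt_comp_line_gradient hF a v t).sub
      ((hasDerivAt_id t).mul_const ⟪gradient F a, v⟫)).sub
      ((hasDerivAt_pow 2 t).const_mul (β / 2 * ‖v‖ ^ 2))) ?_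
    norm_num
    ring
  have hanti := antitoneOn_of_deriv_nonpos (convex_Icc (0 : ℝ) 1)
    (fun t _ => (hderiv t).continuousAt.continuousWithinAt)
    (fun t _ => (hderiv t).differentiableAt.differentiableWithinAt) (fun t ht => by
      rw [interior_Icc] at ht
      rw [(hderiv t).deriv, ← inner_sub_left]
      have hbound := hlip (a + t • v) a
      rw [add_sub_cancel_left, norm_smul, Real.norm_of_nonneg ht.1.le] at hbound
      have hcs := real_inner_le_norm (gradient F (a + t • v) - gradient F a) v
      have hmul := mul_le_mul_of_nonneg_right hbound (norm_nonneg v)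
      linarith)
  have h := hanti (Set.left_mem_Icc.2 zero_le_one) (Set.right_mem_Icc.2 zero_le_one) zero_le_one
  simp [-inner_gradient_left] at h
  linarith

/-- A convex function with `β`-Lipschitz gradient exceeds its tangent planes by a multiple of
the squared distance of the gradients. -/
theorem ConvexOn.add_inner_gradient_add_sq_le (hFc : ConvexOn ℝ Set.univ F)
    (hF : Differentiable ℝ F) (hβ : 0 < β)
    (hlip : ∀ a b, ‖gradient F a - gradient F b‖ ≤ β * ‖a - b‖) (x y : E) :
    F y + ⟪gradient F y, x - y⟫ + 1 / (2 * β) * ‖gradient F x - gradient F y‖ ^ 2 ≤ F x := by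
  set p := gradient F x - gradient F y with hp
  have hlower := hFc.add_inner_gradient_le hF y (x - y + (-(1 / β)) • p)
  have hupper := le_add_inner_gradient_add_sq hF hlip x ((-(1 / β)) • p)
  rw [← add_assoc, add_sub_cancel, inner_add_right, real_inner_smul_right] at hlower
  rw [real_inner_smul_right, norm_smul, mul_pow, Real.norm_eq_abs, sq_abs] at hupper
  have hsq : ⟪gradient F x, p⟫ - ⟪gradient F y, p⟫ = ‖p‖ ^ 2 := by
    rw [← inner_sub_left, ← hp, real_inner_self_eq_norm_sq]
  have hcoef : β / 2 * ((-(1 / β)) ^ 2 * ‖p‖ ^ 2) = 1 / (2 * β) * ‖p‖ ^ 2 := by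
    field_simp
  have hscaled : 1 / β * ⟪gradient F x, p⟫ - 1 / β * ⟪gradient F y, p⟫ =
      2 * (1 / (2 * β) * ‖p‖ ^ 2) := by
    rw [← mul_sub, hsq]
    field_simp
  linarith

end Gradient

/-- Baillon–Haddad: the gradient of a convex function with `β`-Lipschitz gradient
is `1/β`-cocoercive. -/
theorem baillon_haddad {n : ℕ}
    (F : EuclideanSpace ℝ (Fin n) → ℝ)
    (hFc : ConvexOn ℝ Set.univ F) (hF : Differentiable ℝ F)
    (β : ℝ) (hβ : 0 < β)
    (hlip : ∀ a b, ‖gradient F a - gradient F b‖ ≤ β * ‖a - b‖)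
    (x y : EuclideanSpace ℝ (Fin n)) :
    (1/β) * ‖gradient F x - gradient F y‖ ^ 2 ≤
      ⟪gradient F x - gradient F y, x - y⟫ := by
  have hxy := hFc.add_inner_gradient_add_sq_le hF hβ hlip x y
  have hyx := hFc.add_inner_gradient_add_sq_le hF hβ hlip y x
  rw [norm_sub_rev, ← neg_sub x y, inner_neg_right] at hyx
  have hcoef : 1 / β * ‖gradient F x - gradient F y‖ ^ 2 =
      2 * (1 / (2 * β) * ‖gradient F x - gradient F y‖ ^ 2) := by
    field_simp
  rw [inner_sub_left]
  linarith
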